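/- arXiv:1504.00935 — 2 statements merged into one kernel-verified Lean document; each statement's English description precedes it below -/
import Mathlib

section
/- Let 1 < p < 2. There exists a constant c_p ∈ (0,∞), depending only on p, with the following property: for every σ-finite measure ν on (0,∞) satisfying ∫_0^∞ y ν(dy) < ∞, and every nonnegative random variable X whose Laplace transform satisfies E[e^{−θX}] = exp(−∫_0^∞ (1 − e^{−θy}) ν(dy)) for all θ ≥ 0, one has E[X^p] ≤ c_p ( ∫_0^∞ y^p ν(dy) + ( ∫_0^∞ y ν(dy) )^p ). -/
open MeasureTheory Set

/-- The compensated exponential `e^{-t} - 1 + t`, nonnegative on `ℝ`. -/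
noncomputable def compExp (t : ℝ) : ℝ := Real.exp (-t) - 1 + t

lemma compExp_nonneg (t : ℝ) : 0 ≤ compExp t := by
  have := Real.add_one_le_exp (-t)
  unfold compExp; linarith

lemma compExp_pos {t : ℝ} (ht : t ≠ 0) : 0 < compExp t := by
  have := Real.add_one_lt_exp (neg_ne_zero.mpr ht)
  unfold compExp; linarith

@[fun_prop]
lemma continuous_compExp : Continuous compExp := by
  unfold compExp; fun_prop

lemma compExp_le_self {t : ℝ} (ht : 0 ≤ t) : compExp t ≤ t := by
  have : Real.exp (-t) ≤ 1 := Real.exp_le_one_iff.mpr (by linarith)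
  unfold compExp; linarith

lemma compExp_le_sq {t : ℝ} (h0 : 0 ≤ t) (h1 : t ≤ 1) : compExp t ≤ t ^ 2 := by
  have h := Real.abs_exp_sub_one_sub_id_le (x := -t) (by rw [abs_neg, abs_of_nonneg h0]; exact h1)
  have := le_of_abs_le h
  unfold compExp; linarith [neg_sq t]

lemma compExp_mono {s t : ℝ} (hs : 0 ≤ s) (hst : s ≤ t) : compExp s ≤ compExp t := by
  have h1 : Real.exp (-s) ≤ 1 := Real.exp_le_one_iff.mpr (by linarith)
  have h2 := Real.add_one_le_exp (s - t)
  have h3 : Real.exp (-t) = Real.exp (-s) * Real.exp (s - t) := by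
    rw [← Real.exp_add]; ring_nf
  unfold compExp
  rw [h3]
  nlinarith [Real.exp_pos (-s)]

/-- The Mellin-type kernel `∫_0^∞ (e^{-θx} - 1 + θx) θ^{-p-1} dθ`. -/
noncomputable def mellinCompExp (p x : ℝ) : ENNReal :=
  ∫⁻ θ in Ioi (0 : ℝ), ENNReal.ofReal (θ ^ (-p - 1)) * ENNReal.ofReal (compExp (θ * x))

lemma mellinCompExp_zero {p : ℝ} : mellinCompExp p 0 = 0 := by
  simp [mellinCompExp, compExp]

lemma mellinCompExp_of_pos (p : ℝ) {x : ℝ} (hx : 0 < x) :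
    mellinCompExp p x = ENNReal.ofReal (x ^ p) * mellinCompExp p 1 := by
  have himg : (fun u : ℝ => x * u) '' Ioi 0 = Ioi 0 := by
    rw [image_mul_left_Ioi hx, mul_zero]
  have hcv := lintegral_image_eq_lintegral_abs_deriv_mul (s := Ioi (0 : ℝ))
    (f := fun u : ℝ => x * u) (f' := fun _ => x) measurableSet_Ioi
    (fun u _ => by simpa using ((hasDerivAt_id u).const_mul x).hasDerivWithinAt)
    (mul_right_injective₀ hx.ne').injOn
    (fun θ => ENNReal.ofReal (θ ^ (-p - 1)) * ENNReal.ofReal (compExp (θ * 1)))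
  rw [himg] at hcv
  unfold mellinCompExp
  rw [hcv, ← lintegral_const_mul _ (by fun_prop)]
  refine setLIntegral_congr_fun measurableSet_Ioi fun θ hθ => ?_
  have hθ' : (0 : ℝ) ≤ θ := le_of_lt hθ
  have hpow : x ^ p * (x * (x * θ) ^ (-p - 1)) = θ ^ (-p - 1) := by
    rw [Real.mul_rpow hx.le hθ', ← mul_assoc, ← mul_assoc, ← Real.rpow_add_one hx.ne',
      ← Real.rpow_add hx, show p + 1 + (-p - 1) = 0 by ring, Real.rpow_zero, one_mul]
  simp only [abs_of_pos hx, mul_one]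
  rw [← mul_assoc, ← mul_assoc, mul_assoc (ENNReal.ofReal (x ^ p)), ← ENNReal.ofReal_mul hx.le,
    ← ENNReal.ofReal_mul (Real.rpow_nonneg hx.le p), hpow, mul_comm x θ]

lemma mellinCompExp_of_nonneg {p : ℝ} (hp : 0 < p) {x : ℝ} (hx : 0 ≤ x) :
    mellinCompExp p x = ENNReal.ofReal (x ^ p) * mellinCompExp p 1 := by
  rcases hx.eq_or_lt with rfl | hx
  · simp [mellinCompExp_zero, Real.zero_rpow hp.ne']
  · exact mellinCompExp_of_pos p hx

lemma mellinCompExp_one_ne_zero (p : ℝ) : mellinCompExp p 1 ≠ 0 := by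
  unfold mellinCompExp
  refine ((setLIntegral_pos_iff (by fun_prop)).mpr ?_).ne'
  have : Ioi (0 : ℝ) ⊆ Function.support (fun θ : ℝ =>
      ENNReal.ofReal (θ ^ (-p - 1)) * ENNReal.ofReal (compExp (θ * 1))) := by
    intro θ (hθ : 0 < θ)
    have h1 : 0 < θ ^ (-p - 1) := Real.rpow_pos_of_pos hθ _
    have h2 : 0 < compExp θ := compExp_pos hθ.ne'
    simp [h1, h2]
  rw [inter_eq_self_of_subset_right this]
  simp

lemma mellinCompExp_one_ne_top {p : ℝ} (hp1 : 1 < p) (hp2 : p < 2) : mellinCompExp p 1 ≠ ⊤ := by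
  unfold mellinCompExp
  rw [← Ioc_union_Ioi_eq_Ioi zero_le_one]
  refine ((lintegral_union_le _ _ _).trans_lt (ENNReal.add_lt_top.mpr ⟨?_, ?_⟩)).ne
  · have hint : IntegrableOn (fun θ : ℝ => θ ^ (1 - p)) (Ioc 0 1) :=
      (intervalIntegrable_iff_integrableOn_Ioc_of_le zero_le_one).mp
        (intervalIntegral.intervalIntegrable_rpow' (by linarith))
    refine (setLIntegral_mono (by fun_prop) fun θ hθ => ?_).trans_lt hint.setLIntegral_lt_top
    rw [← ENNReal.ofReal_mul (Real.rpow_nonneg hθ.1.le _), mul_one]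
    refine ENNReal.ofReal_le_ofReal ?_
    calc θ ^ (-p - 1) * compExp θ ≤ θ ^ (-p - 1) * θ ^ 2 :=
          mul_le_mul_of_nonneg_left (compExp_le_sq hθ.1.le hθ.2) (Real.rpow_nonneg hθ.1.le _)
      _ = θ ^ (1 - p) := by
          rw [← Real.rpow_two, ← Real.rpow_add hθ.1]; ring_nf
  · have hint : IntegrableOn (fun θ : ℝ => θ ^ (-p)) (Ioi 1) :=
      integrableOn_Ioi_rpow_of_lt (by linarith) one_pos
    refine (setLIntegral_mono (by fun_prop) fun θ hθ => ?_).trans_lt hint.setLIntegral_lt_top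
    have hθ : (0 : ℝ) < θ := one_pos.trans hθ
    rw [← ENNReal.ofReal_mul (Real.rpow_nonneg hθ.le _), mul_one]
    refine ENNReal.ofReal_le_ofReal ?_
    calc θ ^ (-p - 1) * compExp θ ≤ θ ^ (-p - 1) * θ :=
          mul_le_mul_of_nonneg_left (compExp_le_self hθ.le) (Real.rpow_nonneg hθ.le _)
      _ = θ ^ (-p) := by
          rw [← Real.rpow_add_one hθ.ne']; ring_nf

/-- Integrating the kernel against a law of a nonnegative variable produces its `p`-th moment. -/
lemma lintegral_rpow_mul_mellinCompExp {α : Type*} [MeasurableSpace α] {μ : Measure α}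
    [SFinite μ] {Y : α → ℝ} (hY : Measurable Y) (hY0 : ∀ᵐ a ∂μ, 0 ≤ Y a) {p : ℝ} (hp : 0 < p) :
    (∫⁻ a, ENNReal.ofReal (Y a ^ p) ∂μ) * mellinCompExp p 1 =
      ∫⁻ θ in Ioi (0 : ℝ), ENNReal.ofReal (θ ^ (-p - 1)) *
        ∫⁻ a, ENNReal.ofReal (compExp (θ * Y a)) ∂μ := by
  rw [← lintegral_mul_const _ (by fun_prop)]
  calc ∫⁻ a, ENNReal.ofReal (Y a ^ p) * mellinCompExp p 1 ∂μ
      = ∫⁻ a, mellinCompExp p (Y a) ∂μ :=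
        lintegral_congr_ae (hY0.mono fun a ha => (mellinCompExp_of_nonneg hp ha).symm)
    _ = ∫⁻ θ in Ioi (0 : ℝ), ∫⁻ a, ENNReal.ofReal (θ ^ (-p - 1)) *
          ENNReal.ofReal (compExp (θ * Y a)) ∂μ :=
        lintegral_lintegral_swap (Measurable.aemeasurable (by fun_prop))
    _ = _ := lintegral_congr fun θ => lintegral_const_mul _ (by fun_prop)

lemma integrable_one_sub_exp {α : Type*} [MeasurableSpace α] {μ : Measure α} {Y : α → ℝ}
    (hY : Integrable Y μ) (hY0 : ∀ᵐ a ∂μ, 0 ≤ Y a) {θ : ℝ} (hθ : 0 ≤ θ) :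
    Integrable (fun a => 1 - Real.exp (-(θ * Y a))) μ := by
  refine (hY.const_mul θ).mono' ?_ (hY0.mono fun a ha => ?_)
  · exact (by fun_prop : Continuous fun y : ℝ => 1 - Real.exp (-(θ * y))).comp_aestronglyMeasurable
      hY.aestronglyMeasurable
  · have h1 := Real.add_one_le_exp (-(θ * Y a))
    have h2 : Real.exp (-(θ * Y a)) ≤ 1 :=
      Real.exp_le_one_iff.mpr (neg_nonpos.mpr (mul_nonneg hθ ha))
    rw [Real.norm_of_nonneg (by linarith)]
    linarith

lemma compExp_eq (t : ℝ) : compExp t = t - (1 - Real.exp (-t)) := by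
  unfold compExp; ring

lemma integral_compExp {α : Type*} [MeasurableSpace α] {μ : Measure α} {Y : α → ℝ}
    (hY : Integrable Y μ) (hY0 : ∀ᵐ a ∂μ, 0 ≤ Y a) {θ : ℝ} (hθ : 0 ≤ θ) :
    ∫ a, compExp (θ * Y a) ∂μ = θ * ∫ a, Y a ∂μ - ∫ a, (1 - Real.exp (-(θ * Y a))) ∂μ := by
  simp_rw [compExp_eq]
  rw [integral_sub (hY.const_mul θ) (integrable_one_sub_exp hY hY0 hθ), integral_const_mul]

lemma lintegral_compExp {α : Type*} [MeasurableSpace α] {μ : Measure α} {Y : α → ℝ}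
    (hY : Integrable Y μ) (hY0 : ∀ᵐ a ∂μ, 0 ≤ Y a) {θ : ℝ} (hθ : 0 ≤ θ) :
    ∫⁻ a, ENNReal.ofReal (compExp (θ * Y a)) ∂μ =
      ENNReal.ofReal (∫ a, compExp (θ * Y a) ∂μ) := by
  refine (ofReal_integral_eq_lintegral_ofReal ?_ (ae_of_all _ fun _ => compExp_nonneg _)).symm
  simp_rw [compExp_eq]
  exact (hY.const_mul θ).sub (integrable_one_sub_exp hY hY0 hθ)

/-- A bound on the Laplace transform near `0` bounds the mean. -/
lemma lintegral_le_of_laplace {Ω : Type*} [MeasurableSpace Ω] {P : Measure Ω}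
    [IsProbabilityMeasure P] {X : Ω → ℝ} (hX : Measurable X) (hX0 : ∀ ω, 0 ≤ X ω) {m : ℝ}
    (h : ∀ θ : ℝ, 0 < θ → 1 - ∫ ω, Real.exp (-(θ * X ω)) ∂P ≤ θ * m) :
    ∫⁻ ω, ENNReal.ofReal (X ω) ∂P ≤ ENNReal.ofReal m := by
  set t : ℕ → ℝ := fun n => 1 / ((n : ℝ) + 1)
  have ht : ∀ n, 0 < t n := fun n => Nat.one_div_pos_of_nat
  have hle : ∀ n, ∫⁻ ω, ENNReal.ofReal ((t n)⁻¹ * (1 - Real.exp (-(t n * X ω)))) ∂P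
      ≤ ENNReal.ofReal m := by
    intro n
    have hexp : ∀ ω, Real.exp (-(t n * X ω)) ≤ 1 := fun ω =>
      Real.exp_le_one_iff.mpr (neg_nonpos.mpr (mul_nonneg (ht n).le (hX0 ω)))
    have hint : Integrable (fun ω => Real.exp (-(t n * X ω))) P := by
      refine Integrable.of_bound (C := 1) (by fun_prop) (ae_of_all _ fun ω => ?_)
      rw [Real.norm_of_nonneg (Real.exp_pos _).le]
      exact hexp ω
    have hint' : Integrable (fun ω => (t n)⁻¹ * (1 - Real.exp (-(t n * X ω)))) P :=
      ((integrable_const 1).sub hint).const_mul _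
    rw [← ofReal_integral_eq_lintegral_ofReal hint'
      (ae_of_all _ fun ω => mul_nonneg (inv_nonneg.mpr (ht n).le) (sub_nonneg.mpr (hexp ω))),
      integral_const_mul, integral_sub (integrable_const 1) hint]
    refine ENNReal.ofReal_le_ofReal ?_
    rw [inv_mul_le_iff₀ (ht n)]
    simpa using h (t n) (ht n)
  have hlim : ∀ ω, Filter.Tendsto
      (fun n => ENNReal.ofReal ((t n)⁻¹ * (1 - Real.exp (-(t n * X ω))))) Filter.atTop
      (nhds (ENNReal.ofReal (X ω))) := by
    intro ω
    refine ENNReal.tendsto_ofReal ?_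
    have hd : HasDerivAt (fun s : ℝ => 1 - Real.exp (-(s * X ω))) (X ω) 0 := by
      have := (((hasDerivAt_id (0 : ℝ)).mul_const (X ω)).neg.exp).const_sub 1
      simpa using this
    have htend : Filter.Tendsto t Filter.atTop (nhdsWithin 0 {0}ᶜ) :=
      tendsto_nhdsWithin_iff.mpr ⟨tendsto_one_div_add_atTop_nhds_zero_nat,
        Filter.Eventually.of_forall fun n => (ht n).ne'⟩
    simpa [Function.comp_def] using hd.tendsto_slope_zero.comp htend
  calc ∫⁻ ω, ENNReal.ofReal (X ω) ∂P
      = ∫⁻ ω, Filter.liminf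
          (fun n => ENNReal.ofReal ((t n)⁻¹ * (1 - Real.exp (-(t n * X ω))))) Filter.atTop ∂P :=
        lintegral_congr fun ω => (hlim ω).liminf_eq.symm
    _ ≤ Filter.liminf (fun n =>
          ∫⁻ ω, ENNReal.ofReal ((t n)⁻¹ * (1 - Real.exp (-(t n * X ω)))) ∂P) Filter.atTop :=
        lintegral_liminf_le fun n => by fun_prop
    _ ≤ ENNReal.ofReal m :=
        Filter.liminf_le_of_le (by isBoundedDefault) fun b hb =>
          let ⟨n, hn⟩ := hb.exists
          hn.trans (hle n)


/-- Let `1 < p < 2`. There exists a constant `c_p ∈ (0,∞)`, depending only on `p`, such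
that: for every σ-finite measure `ν` on `(0,∞)` satisfying `∫_0^∞ y ν(dy) < ∞`, and every
nonnegative random variable `X` whose Laplace transform satisfies
`E[e^{−θX}] = exp(−∫_0^∞ (1 − e^{−θy}) ν(dy))` for all `θ ≥ 0`, one has
`E[X^p] ≤ c_p (∫_0^∞ y^p ν(dy) + (∫_0^∞ y ν(dy))^p)`. -/
theorem stmt_0 (p : ℝ) (hp1 : 1 < p) (hp2 : p < 2) :
    ∃ c : ℝ, 0 < c ∧
      ∀ (ν : Measure ℝ) [SigmaFinite ν],
        ν (Iic 0) = 0 →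
        (∫⁻ y, ENNReal.ofReal y ∂ν) < ⊤ →
        ∀ (Ω : Type) (_ : MeasurableSpace Ω) (P : Measure Ω) (_ : IsProbabilityMeasure P)
          (X : Ω → ℝ), Measurable X → (∀ ω, 0 ≤ X ω) →
          (∀ θ : ℝ, 0 ≤ θ →
            ∫ ω, Real.exp (-(θ * X ω)) ∂P
              = Real.exp (-(∫ y, (1 - Real.exp (-(θ * y))) ∂ν))) →
          ∫⁻ ω, ENNReal.ofReal (X ω ^ p) ∂P
            ≤ ENNReal.ofReal c *
                ((∫⁻ y, ENNReal.ofReal (y ^ p) ∂ν)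
                  + (∫⁻ y, ENNReal.ofReal y ∂ν) ^ p) := by
  refine ⟨1, one_pos, fun ν _ hν hfin Ω _ P _ X hX hX0 hL => ?_⟩
  have hp : 0 < p := one_pos.trans hp1
  have hpos : ∀ᵐ y ∂ν, 0 ≤ y := by
    refine measure_mono_null (fun y hy => ?_) hν
    exact (not_le.mp (show ¬ 0 ≤ y from hy)).le
  have hνint : Integrable (fun y : ℝ => y) ν :=
    (lintegral_ofReal_ne_top_iff_integrable measurable_id.aestronglyMeasurable hpos).mp hfin.ne
  set m : ℝ := ∫ y, y ∂ν
  have hm0 : 0 ≤ m := integral_nonneg_of_ae hpos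
  have hm : ∫⁻ y, ENNReal.ofReal y ∂ν = ENNReal.ofReal m :=
    (ofReal_integral_eq_lintegral_ofReal hνint hpos).symm
  set ψ : ℝ → ℝ := fun θ => ∫ y, (1 - Real.exp (-(θ * y))) ∂ν
  have hψ0 : ∀ θ, 0 ≤ θ → 0 ≤ ψ θ := fun θ hθ =>
    integral_nonneg_of_ae (hpos.mono fun y hy =>
      sub_nonneg.mpr (Real.exp_le_one_iff.mpr (neg_nonpos.mpr (mul_nonneg hθ hy))))
  have hψ : ∀ θ, 0 ≤ θ → ∫ y, compExp (θ * y) ∂ν = θ * m - ψ θ := fun θ hθ =>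
    integral_compExp hνint hpos hθ
  have hψm : ∀ θ, 0 ≤ θ → ψ θ ≤ θ * m := fun θ hθ =>
    sub_nonneg.mp (hψ θ hθ ▸ integral_nonneg fun _ => compExp_nonneg _)
  have hmean : ∫⁻ ω, ENNReal.ofReal (X ω) ∂P ≤ ENNReal.ofReal m := by
    refine lintegral_le_of_laplace hX hX0 fun θ hθ => ?_
    rw [hL θ hθ.le]
    have := Real.add_one_le_exp (-(ψ θ))
    linarith [hψm θ hθ.le]
  have hX0' : ∀ᵐ ω ∂P, 0 ≤ X ω := ae_of_all _ hX0
  have hXint : Integrable X P :=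
    (lintegral_ofReal_ne_top_iff_integrable hX.aestronglyMeasurable hX0').mp
      (hmean.trans_lt ENNReal.ofReal_lt_top).ne
  have hEX : ∫ ω, X ω ∂P ≤ m := by
    rwa [← ofReal_integral_eq_lintegral_ofReal hXint hX0', ENNReal.ofReal_le_ofReal_iff hm0]
      at hmean
  have key : ∀ θ : ℝ, 0 < θ → ∫⁻ ω, ENNReal.ofReal (compExp (θ * X ω)) ∂P ≤
      ∫⁻ y, ENNReal.ofReal (compExp (θ * y)) ∂ν + ENNReal.ofReal (compExp (θ * m)) := by
    intro θ hθ
    have hexp : Integrable (fun ω => Real.exp (-(θ * X ω))) P := by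
      simpa [Pi.sub_def] using
        (integrable_const (1 : ℝ)).sub (integrable_one_sub_exp hXint hX0' hθ.le)
    rw [lintegral_compExp hXint hX0' hθ.le, lintegral_compExp hνint hpos hθ.le,
      ← ENNReal.ofReal_add (integral_nonneg fun _ => compExp_nonneg _) (compExp_nonneg _),
      integral_compExp hXint hX0' hθ.le, hψ θ hθ.le,
      integral_sub (integrable_const 1) hexp, hL θ hθ.le]
    refine ENNReal.ofReal_le_ofReal ?_
    have hmono := compExp_mono (hψ0 θ hθ.le) (hψm θ hθ.le)
    have hle := mul_le_mul_of_nonneg_left hEX hθ.le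
    have hdef : compExp (ψ θ) = Real.exp (-(ψ θ)) - 1 + ψ θ := rfl
    simp only [integral_const, probReal_univ, smul_eq_mul, mul_one]
    linarith
  rw [ENNReal.ofReal_one, one_mul, hm, ENNReal.ofReal_rpow_of_nonneg hm0 hp.le]
  refine (ENNReal.mul_le_mul_iff_left (mellinCompExp_one_ne_zero p)
    (mellinCompExp_one_ne_top hp1 hp2)).mp ?_
  rw [add_mul, ← mellinCompExp_of_nonneg hp hm0,
    lintegral_rpow_mul_mellinCompExp hX hX0' hp,
    lintegral_rpow_mul_mellinCompExp (Y := fun y : ℝ => y) measurable_id hpos hp, mellinCompExp,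
    ← lintegral_add_right _ (by fun_prop)]
  refine setLIntegral_mono' measurableSet_Ioi fun θ hθ => ?_
  rw [← mul_add]
  exact mul_le_mul_right (key θ hθ) _
end

section
/- Let 2 < p < 4. There exists a constant c_p ∈ (0,∞), depending only on p, with the following property: for every symmetric σ-finite measure ν on ℝ \ {0} (i.e., ν(−A) = ν(A) for all Borel A) satisfying ∫_ℝ min(1, y²) ν(dy) < ∞ and ∫_{|y|≥1} y² ν(dy) < ∞, and every random variable Y whose characteristic function satisfies E[e^{iθY}] = exp( ∫_ℝ (e^{iθy} − 1 − iθy) ν(dy) ) for all θ ∈ ℝ, one has E[|Y|^p] ≤ c_p ( ∫_ℝ |y|^p ν(dy) + ( ∫_ℝ y² ν(dy) )^{p/2} ). -/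
open MeasureTheory Set

/-- The second order remainder of the cosine at `0`, which is nonnegative. -/
noncomputable def cosRemainder (u : ℝ) : ℝ := Real.cos u - 1 + u ^ 2 / 2

theorem continuous_cosRemainder : Continuous cosRemainder := by
  unfold cosRemainder
  fun_prop

theorem cosRemainder_nonneg (u : ℝ) : 0 ≤ cosRemainder u := by
  have := Real.one_sub_sq_div_two_le_cos (x := u)
  unfold cosRemainder
  linarith

theorem cosRemainder_le_sq (u : ℝ) : cosRemainder u ≤ u ^ 2 := by
  have := Real.cos_le_one u
  unfold cosRemainder
  nlinarith [sq_nonneg u]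

theorem cosRemainder_le_pow_four (u : ℝ) : cosRemainder u ≤ u ^ 4 := by
  rcases le_total |u| 1 with h | h
  · have h1 := (abs_le.1 (Real.cos_bound h)).2
    have h2 : |u| ^ 4 = u ^ 4 := by rw [← abs_pow, abs_of_nonneg (by positivity)]
    rw [h2] at h1
    have : 0 ≤ u ^ 4 := by positivity
    unfold cosRemainder
    linarith
  · have h1 : 1 ≤ u ^ 2 := (one_le_sq_iff_one_le_abs u).2 h
    nlinarith [cosRemainder_le_sq u]

theorem sq_div_four_le_cosRemainder {u : ℝ} (hu : 4 ≤ |u|) : u ^ 2 / 4 ≤ cosRemainder u := by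
  have h1 := Real.neg_one_le_cos u
  have h2 : 16 ≤ u ^ 2 := by
    rw [← sq_abs]
    nlinarith
  unfold cosRemainder
  linarith

theorem exp_neg_sub_one_add_le_sq {t : ℝ} (ht : 0 ≤ t) : Real.exp (-t) - 1 + t ≤ t ^ 2 := by
  rcases le_total t 1 with h | h
  · have h1 := (abs_le.1 (Real.abs_exp_sub_one_sub_id_le (x := -t) (by
      rwa [abs_neg, abs_of_nonneg ht]))).2
    linarith [neg_sq t]
  · have : Real.exp (-t) ≤ 1 := Real.exp_le_one_iff.2 (by linarith)
    nlinarith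

theorem norm_exp_I_mul_sub_one_sub_le (u : ℝ) :
    ‖Complex.exp (Complex.I * u) - 1 - Complex.I * u‖ ≤ 3 * u ^ 2 := by
  have hn : ‖Complex.I * (u : ℂ)‖ = |u| := by simp
  rcases le_total |u| 1 with h | h
  · have := Complex.norm_exp_sub_one_sub_id_le (x := Complex.I * u) (by rwa [hn])
    rw [hn, sq_abs] at this
    nlinarith [sq_nonneg u]
  · have h1 : ‖Complex.exp (Complex.I * u) - 1‖ ≤ |u| := by
      simpa using Real.norm_exp_I_mul_ofReal_sub_one_le (x := u)
    have h2 := norm_sub_le (Complex.exp (Complex.I * u) - 1) (Complex.I * u)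
    rw [hn] at h2
    nlinarith [sq_abs u]

theorem lintegral_min_mul_rpow_le {p s : ℝ} (hp2 : 2 < p) (hp4 : p < 4) (hs : 0 ≤ s) :
    ∫⁻ θ in Ioi (0 : ℝ), ENNReal.ofReal (min ((θ * s) ^ 4) ((θ * s) ^ 2) * θ ^ (-p - 1))
      ≤ ENNReal.ofReal (1 / (4 - p) + 1 / (p - 2)) * ENNReal.ofReal (s ^ p) := by
  have h4 : 0 < 4 - p := by linarith
  have h2 : 0 < p - 2 := by linarith
  rcases hs.eq_or_lt with rfl | hs
  · simp
  have hi : 0 < s⁻¹ := inv_pos.2 hs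
  have hsmall : ∫⁻ θ in Ioc 0 s⁻¹,
      ENNReal.ofReal (min ((θ * s) ^ 4) ((θ * s) ^ 2) * θ ^ (-p - 1))
        ≤ ENNReal.ofReal (s ^ p / (4 - p)) := by
    have hfint : IntegrableOn (fun θ : ℝ => s ^ 4 * θ ^ (3 - p)) (Ioc 0 s⁻¹) := by
      refine Integrable.const_mul ?_ _
      exact (intervalIntegrable_iff_integrableOn_Ioc_of_le hi.le).1
        (intervalIntegral.intervalIntegrable_rpow' (by linarith))
    have hval : ∫ θ in Ioc 0 s⁻¹, s ^ 4 * θ ^ (3 - p) = s ^ p / (4 - p) := by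
      rw [integral_const_mul, ← intervalIntegral.integral_of_le hi.le,
        integral_rpow (Or.inl (by linarith)), show (3 - p + 1) = 4 - p by ring,
        Real.zero_rpow h4.ne', Real.inv_rpow hs.le, ← Real.rpow_neg hs.le,
        sub_zero, ← mul_div_assoc, ← Real.rpow_natCast, ← Real.rpow_add hs]
      congr 2
      push_cast
      ring
    rw [← hval, ofReal_integral_eq_lintegral_ofReal hfint]
    · refine setLIntegral_mono' measurableSet_Ioc fun θ hθ => ENNReal.ofReal_le_ofReal ?_
      have h0 : 0 < θ := hθ.1
      have : θ ^ (3 - p) = θ ^ 4 * θ ^ (-p - 1) := by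
        rw [← Real.rpow_natCast, ← Real.rpow_add h0]
        congr 1
        push_cast
        ring
      rw [this, ← mul_assoc, ← mul_pow, mul_comm s]
      exact mul_le_mul_of_nonneg_right (min_le_left _ _) (by positivity)
    · filter_upwards [ae_restrict_mem measurableSet_Ioc] with θ hθ
      have h0 : 0 < θ := hθ.1
      positivity
  have hlarge : ∫⁻ θ in Ioi s⁻¹,
      ENNReal.ofReal (min ((θ * s) ^ 4) ((θ * s) ^ 2) * θ ^ (-p - 1))
        ≤ ENNReal.ofReal (s ^ p / (p - 2)) := by
    have hfint : IntegrableOn (fun θ : ℝ => s ^ 2 * θ ^ (1 - p)) (Ioi s⁻¹) :=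
      (integrableOn_Ioi_rpow_of_lt (by linarith) hi).const_mul _
    have hval : ∫ θ in Ioi s⁻¹, s ^ 2 * θ ^ (1 - p) = s ^ p / (p - 2) := by
      rw [integral_const_mul, integral_Ioi_rpow_of_lt (by linarith) hi,
        Real.inv_rpow hs.le, ← Real.rpow_neg hs.le, show (1 - p + 1) = -(p - 2) by ring,
        neg_div_neg_eq, neg_neg, ← mul_div_assoc, ← Real.rpow_natCast, ← Real.rpow_add hs]
      congr 2
      push_cast
      ring
    rw [← hval, ofReal_integral_eq_lintegral_ofReal hfint]
    · refine setLIntegral_mono' measurableSet_Ioi fun θ hθ => ENNReal.ofReal_le_ofReal ?_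
      have h0 : 0 < θ := hi.trans hθ
      have : θ ^ (1 - p) = θ ^ 2 * θ ^ (-p - 1) := by
        rw [← Real.rpow_natCast, ← Real.rpow_add h0]
        congr 1
        push_cast
        ring
      rw [this, ← mul_assoc, ← mul_pow, mul_comm s]
      exact mul_le_mul_of_nonneg_right (min_le_right _ _) (by positivity)
    · filter_upwards [ae_restrict_mem measurableSet_Ioi] with θ hθ
      have h0 : 0 < θ := hi.trans hθ
      positivity
  rw [← Ioc_union_Ioi_eq_Ioi hi.le]
  refine (lintegral_union_le _ _ _).trans ((add_le_add hsmall hlarge).trans_eq ?_)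
  rw [← ENNReal.ofReal_add (by positivity) (by positivity), ← ENNReal.ofReal_mul (by positivity)]
  congr 1
  ring

theorem lintegral_cosRemainder_le {p : ℝ} (hp2 : 2 < p) (hp4 : p < 4) (x : ℝ) :
    ∫⁻ θ in Ioi (0 : ℝ), ENNReal.ofReal (cosRemainder (θ * x) * θ ^ (-p - 1))
      ≤ ENNReal.ofReal (1 / (4 - p) + 1 / (p - 2)) * ENNReal.ofReal (|x| ^ p) := by
  refine le_trans (setLIntegral_mono' measurableSet_Ioi fun θ hθ => ?_)
    (lintegral_min_mul_rpow_le hp2 hp4 (abs_nonneg x))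
  have h0 : 0 < θ := hθ
  refine ENNReal.ofReal_le_ofReal (mul_le_mul_of_nonneg_right ?_ (by positivity))
  have h4 : |x| ^ 4 = x ^ 4 := by rw [← abs_pow, abs_of_nonneg (by positivity)]
  rw [mul_pow, mul_pow, sq_abs, h4, ← mul_pow, ← mul_pow]
  exact le_min (cosRemainder_le_pow_four _) (cosRemainder_le_sq _)

theorem le_lintegral_cosRemainder {p : ℝ} (hp2 : 2 < p) (x : ℝ) :
    ENNReal.ofReal (4 ^ (1 - p) / (p - 2)) * ENNReal.ofReal (|x| ^ p)
      ≤ ∫⁻ θ in Ioi (0 : ℝ), ENNReal.ofReal (cosRemainder (θ * x) * θ ^ (-p - 1)) := by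
  have h2 : 0 < p - 2 := by linarith
  rcases eq_or_ne x 0 with rfl | hx
  · rw [abs_zero, Real.zero_rpow (by linarith)]
    simp
  have hx : 0 < |x| := abs_pos.2 hx
  have hi : 0 < 4 / |x| := by positivity
  have hfint : IntegrableOn (fun θ : ℝ => x ^ 2 / 4 * θ ^ (1 - p)) (Ioi (4 / |x|)) :=
    (integrableOn_Ioi_rpow_of_lt (by linarith) hi).const_mul _
  have hval : ∫ θ in Ioi (4 / |x|), x ^ 2 / 4 * θ ^ (1 - p)
      = 4 ^ (1 - p) / (p - 2) * |x| ^ p := by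
    have e1 : |x| ^ p = |x| ^ 2 * |x| ^ (p - 2) := by
      rw [← Real.rpow_natCast, ← Real.rpow_add hx]
      congr 1
      push_cast
      ring
    have e2 : (4 : ℝ) ^ (-(p - 2)) = 4 * 4 ^ (1 - p) := by
      rw [show -(p - 2) = 1 + (1 - p) by ring, Real.rpow_add (by norm_num), Real.rpow_one]
    rw [integral_const_mul, integral_Ioi_rpow_of_lt (by linarith) hi,
      show (1 - p + 1) = -(p - 2) by ring, neg_div_neg_eq,
      Real.div_rpow (by norm_num) hx.le, Real.rpow_neg hx.le, e1, e2, sq_abs]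
    field_simp
  rw [← ENNReal.ofReal_mul (by positivity), ← hval, ofReal_integral_eq_lintegral_ofReal hfint]
  · refine le_trans (setLIntegral_mono' measurableSet_Ioi fun θ hθ => ENNReal.ofReal_le_ofReal ?_)
      (lintegral_mono_set (Ioi_subset_Ioi hi.le))
    have h0 : 0 < θ := hi.trans hθ
    have : θ ^ (1 - p) = θ ^ 2 * θ ^ (-p - 1) := by
      rw [← Real.rpow_natCast, ← Real.rpow_add h0]
      congr 1
      push_cast
      ring
    rw [this, ← mul_assoc, show x ^ 2 / 4 * θ ^ 2 = (θ * x) ^ 2 / 4 by ring]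
    refine mul_le_mul_of_nonneg_right (sq_div_four_le_cosRemainder ?_) (by positivity)
    rw [abs_mul, abs_of_pos h0]
    exact ((div_lt_iff₀ hx).1 hθ).le
  · filter_upwards [ae_restrict_mem measurableSet_Ioi] with θ hθ
    have h0 : 0 < θ := hi.trans hθ
    positivity

theorem integrable_sq_of_lintegral_lt_top {ν : Measure ℝ}
    (hsmall : (∫⁻ y, ENNReal.ofReal (min 1 (y ^ 2)) ∂ν) < ⊤)
    (hlarge : (∫⁻ y in {y : ℝ | 1 ≤ |y|}, ENNReal.ofReal (y ^ 2) ∂ν) < ⊤) :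
    Integrable (fun y : ℝ => y ^ 2) ν := by
  refine ⟨by fun_prop, ?_⟩
  rw [hasFiniteIntegral_iff_ofReal (Filter.Eventually.of_forall fun y => sq_nonneg y)]
  have hm : MeasurableSet {y : ℝ | 1 ≤ |y|} := measurableSet_le measurable_const measurable_norm
  rw [← lintegral_add_compl _ hm]
  refine ENNReal.add_lt_top.2 ⟨hlarge, lt_of_le_of_lt ?_ hsmall⟩
  refine le_trans (setLIntegral_mono' hm.compl fun y hy => ?_) (setLIntegral_le_lintegral _ _)
  have : |y| < 1 := not_le.1 hy
  rw [min_eq_right ((sq_le_one_iff_abs_le_one y).2 this.le)]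

theorem integrable_one_sub_cos {ν : Measure ℝ} (hν : Integrable (fun y : ℝ => y ^ 2) ν) (θ : ℝ) :
    Integrable (fun y => 1 - Real.cos (θ * y)) ν := by
  refine (hν.const_mul (θ ^ 2)).mono' (by fun_prop) (Filter.Eventually.of_forall fun y => ?_)
  rw [Real.norm_of_nonneg (by linarith [Real.cos_le_one (θ * y)]), ← mul_pow]
  nlinarith [Real.one_sub_sq_div_two_le_cos (x := θ * y), sq_nonneg (θ * y)]

theorem integral_one_sub_cos_nonneg (ν : Measure ℝ) (θ : ℝ) :
    0 ≤ ∫ y, (1 - Real.cos (θ * y)) ∂ν :=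
  integral_nonneg fun y => sub_nonneg.2 (Real.cos_le_one (θ * y))

theorem integral_one_sub_cos_le {ν : Measure ℝ} (hν : Integrable (fun y : ℝ => y ^ 2) ν) (θ : ℝ) :
    ∫ y, (1 - Real.cos (θ * y)) ∂ν ≤ θ ^ 2 / 2 * ∫ y, y ^ 2 ∂ν := by
  rw [← integral_const_mul]
  refine integral_mono (integrable_one_sub_cos hν θ) (hν.const_mul _) fun y => ?_
  have := Real.one_sub_sq_div_two_le_cos (x := θ * y)
  dsimp only
  linarith [mul_pow θ y 2]

/-- The Lévy exponent of a symmetric measure is real. -/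
theorem integral_exp_sub_of_symmetric {ν : Measure ℝ} (hsymm : ν.map (fun y => -y) = ν)
    (hν : Integrable (fun y : ℝ => y ^ 2) ν) (θ : ℝ) :
    ∫ y, (Complex.exp (Complex.I * (θ : ℂ) * (y : ℂ)) - 1 - Complex.I * (θ : ℂ) * (y : ℂ)) ∂ν
      = ((-∫ y, (1 - Real.cos (θ * y)) ∂ν : ℝ) : ℂ) := by
  set f : ℝ → ℂ := fun y =>
    Complex.exp (Complex.I * (θ : ℂ) * (y : ℂ)) - 1 - Complex.I * (θ : ℂ) * (y : ℂ) with hf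
  have hcont : Continuous f := by
    rw [hf]
    fun_prop
  have hfint : Integrable f ν := by
    refine (hν.const_mul (3 * θ ^ 2)).mono' hcont.aestronglyMeasurable
      (Filter.Eventually.of_forall fun y => ?_)
    have := norm_exp_I_mul_sub_one_sub_le (θ * y)
    push_cast at this
    rw [← mul_assoc] at this
    exact this.trans_eq (by ring)
  have hconj : (starRingEnd ℂ) (∫ y, f y ∂ν) = ∫ y, f y ∂ν := by
    rw [← integral_conj]
    conv_rhs => rw [← hsymm, integral_map (by fun_prop) hcont.aestronglyMeasurable]
    refine integral_congr_ae (Filter.Eventually.of_forall fun y => ?_)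
    simp [hf, ← Complex.exp_conj]
  have hre : (∫ y, f y ∂ν).re = ∫ y, (f y).re ∂ν := (integral_re hfint).symm
  rw [← Complex.conj_eq_iff_re.1 hconj, hre, ← integral_neg]
  congr 1
  refine integral_congr_ae (Filter.Eventually.of_forall fun y => ?_)
  have : Complex.I * (θ : ℂ) * (y : ℂ) = ((θ * y : ℝ) : ℂ) * Complex.I := by
    push_cast
    ring
  simp only [hf, this, Complex.sub_re, Complex.exp_ofReal_mul_I_re]
  simp

theorem integral_cos_of_integral_exp {Ω : Type*} [MeasurableSpace Ω] {P : Measure Ω}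
    [IsFiniteMeasure P] {Y : Ω → ℝ} (hY : Measurable Y) {θ r : ℝ}
    (h : ∫ ω, Complex.exp (Complex.I * (θ : ℂ) * (Y ω : ℂ)) ∂P = (r : ℂ)) :
    ∫ ω, Real.cos (θ * Y ω) ∂P = r := by
  have hre : ∀ ω, Complex.I * (θ : ℂ) * (Y ω : ℂ) = ((θ * Y ω : ℝ) : ℂ) * Complex.I := fun ω => by
    push_cast
    ring
  have hfint : Integrable (fun ω => Complex.exp (Complex.I * (θ : ℂ) * (Y ω : ℂ))) P := by
    refine Integrable.of_bound (by fun_prop) 1 (Filter.Eventually.of_forall fun ω => ?_)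
    rw [hre, Complex.norm_exp_ofReal_mul_I]
  have h1 := integral_re hfint
  simp only [hre] at h1 h
  rw [h] at h1
  simpa only [RCLike.re_eq_complex_re, Complex.exp_ofReal_mul_I_re, Complex.ofReal_re] using h1

/-- A random variable whose characteristic function decays at most quadratically at `0` has a
finite second moment. -/
theorem lintegral_sq_le_of_integral_cos {Ω : Type*} [MeasurableSpace Ω] {P : Measure Ω}
    [IsProbabilityMeasure P] {Y : Ω → ℝ} (hY : Measurable Y) {v : ℝ}
    (h : ∀ θ : ℝ, 1 - ∫ ω, Real.cos (θ * Y ω) ∂P ≤ θ ^ 2 / 2 * v) :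
    ∫⁻ ω, ENNReal.ofReal (Y ω ^ 2) ∂P ≤ ENNReal.ofReal v := by
  set t : ℕ → ℝ := fun n => 1 / ((n : ℝ) + 1) with ht
  have htpos : ∀ n, 0 < t n := fun n => by positivity
  have ht0 : Filter.Tendsto t Filter.atTop (nhds 0) := tendsto_one_div_add_atTop_nhds_zero_nat
  set F : ℕ → Ω → ℝ := fun n ω => 2 / t n ^ 2 * (1 - Real.cos (t n * Y ω)) with hF
  have hlow : ∀ n ω, Y ω ^ 2 - 2 * t n ^ 2 * Y ω ^ 4 ≤ F n ω := fun n ω => by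
    have h1 := cosRemainder_le_pow_four (t n * Y ω)
    unfold cosRemainder at h1
    have h2 : Y ω ^ 2 - 2 * t n ^ 2 * Y ω ^ 4
        = 2 / t n ^ 2 * ((t n * Y ω) ^ 2 / 2 - (t n * Y ω) ^ 4) := by
      have := (htpos n).ne'
      field_simp
    rw [h2]
    have := htpos n
    exact mul_le_mul_of_nonneg_left (by linarith) (by positivity)
  have hlim : ∀ ω, ENNReal.ofReal (Y ω ^ 2)
      ≤ Filter.liminf (fun n => ENNReal.ofReal (F n ω)) Filter.atTop := fun ω => by
    have h1 : Filter.Tendsto (fun n => ENNReal.ofReal (Y ω ^ 2 - 2 * t n ^ 2 * Y ω ^ 4))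
        Filter.atTop (nhds (ENNReal.ofReal (Y ω ^ 2))) := by
      refine ENNReal.tendsto_ofReal ?_
      have := (((ht0.pow 2).const_mul 2).mul_const (Y ω ^ 4)).const_sub (Y ω ^ 2)
      simpa using this
    rw [← h1.liminf_eq]
    exact Filter.liminf_le_liminf
      (Filter.Eventually.of_forall fun n => ENNReal.ofReal_le_ofReal (hlow n ω))
  refine (lintegral_mono hlim).trans ((lintegral_liminf_le fun n => by fun_prop).trans ?_)
  refine Filter.liminf_le_of_le (by isBoundedDefault) fun b hb => ?_
  obtain ⟨n, hn⟩ := hb.exists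
  refine hn.trans ?_
  have hcos : Integrable (fun ω => Real.cos (t n * Y ω)) P :=
    Integrable.of_bound (by fun_prop) 1 (Filter.Eventually.of_forall fun ω => Real.abs_cos_le_one _)
  have hsub : Integrable (fun ω => 1 - Real.cos (t n * Y ω)) P := (integrable_const 1).sub hcos
  have htn := htpos n
  rw [← ofReal_integral_eq_lintegral_ofReal (hsub.const_mul _)
    (Filter.Eventually.of_forall fun ω => mul_nonneg (by positivity)
      (sub_nonneg.2 (Real.cos_le_one _))), integral_const_mul,
    integral_sub (integrable_const 1) hcos]
  refine ENNReal.ofReal_le_ofReal ?_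
  have h1 := mul_le_mul_of_nonneg_left (h (t n)) (by positivity : 0 ≤ 2 / t n ^ 2)
  have h2 : 2 / t n ^ 2 * (t n ^ 2 / 2 * v) = v := by field_simp
  rw [h2] at h1
  simpa using h1

theorem lintegral_cosRemainder_le_of_integral_cos {ν : Measure ℝ}
    (hν : Integrable (fun y : ℝ => y ^ 2) ν)
    {Ω : Type*} [MeasurableSpace Ω] {P : Measure Ω} [IsProbabilityMeasure P]
    {Y : Ω → ℝ} (hY : Measurable Y)
    (h : ∀ θ : ℝ, ∫ ω, Real.cos (θ * Y ω) ∂P = Real.exp (-∫ y, (1 - Real.cos (θ * y)) ∂ν))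
    (θ : ℝ) :
    ∫⁻ ω, ENNReal.ofReal (cosRemainder (θ * Y ω)) ∂P
      ≤ (∫⁻ y, ENNReal.ofReal (cosRemainder (θ * y)) ∂ν)
        + ENNReal.ofReal
          (min ((θ * √(∫ y, y ^ 2 ∂ν)) ^ 4) ((θ * √(∫ y, y ^ 2 ∂ν)) ^ 2)) := by
  set v := ∫ y, y ^ 2 ∂ν
  have hv0 : 0 ≤ v := integral_nonneg fun y => sq_nonneg y
  have hYv : ∫⁻ ω, ENNReal.ofReal (Y ω ^ 2) ∂P ≤ ENNReal.ofReal v := by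
    refine lintegral_sq_le_of_integral_cos hY fun θ => ?_
    rw [h]
    linarith [integral_one_sub_cos_le hν θ,
      Real.add_one_le_exp (-∫ y, (1 - Real.cos (θ * y)) ∂ν)]
  have hYint : Integrable (fun ω => Y ω ^ 2) P := by
    refine ⟨by fun_prop, ?_⟩
    rw [hasFiniteIntegral_iff_ofReal (Filter.Eventually.of_forall fun ω => sq_nonneg _)]
    exact hYv.trans_lt ENNReal.ofReal_lt_top
  have hYle : ∫ ω, Y ω ^ 2 ∂P ≤ v := by
    rw [← ofReal_integral_eq_lintegral_ofReal hYint
      (Filter.Eventually.of_forall fun ω => sq_nonneg _)] at hYv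
    exact (ENNReal.ofReal_le_ofReal_iff hv0).1 hYv
  have hcos : Integrable (fun ω => Real.cos (θ * Y ω)) P :=
    Integrable.of_bound (by fun_prop) 1 (Filter.Eventually.of_forall fun ω => Real.abs_cos_le_one _)
  have hsub : Integrable (fun ω => Real.cos (θ * Y ω) - 1) P := hcos.sub (integrable_const 1)
  have hPeq : (fun ω => cosRemainder (θ * Y ω))
      = fun ω => (Real.cos (θ * Y ω) - 1) + θ ^ 2 / 2 * Y ω ^ 2 := by
    funext ω
    unfold cosRemainder
    ring
  have hPint : Integrable (fun ω => cosRemainder (θ * Y ω)) P := by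
    rw [hPeq]
    exact hsub.add (hYint.const_mul _)
  have hPval : ∫ ω, cosRemainder (θ * Y ω) ∂P
      = Real.exp (-∫ y, (1 - Real.cos (θ * y)) ∂ν) - 1 + θ ^ 2 / 2 * ∫ ω, Y ω ^ 2 ∂P := by
    rw [hPeq, integral_add hsub (hYint.const_mul _),
      integral_sub hcos (integrable_const 1), h, integral_const_mul]
    simp
  have hνeq : (fun y => cosRemainder (θ * y))
      = fun y => θ ^ 2 / 2 * y ^ 2 - (1 - Real.cos (θ * y)) := by
    funext y
    unfold cosRemainder
    ring
  have hνint : Integrable (fun y => cosRemainder (θ * y)) ν := by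
    rw [hνeq]
    exact (hν.const_mul _).sub (integrable_one_sub_cos hν θ)
  have hνval : ∫ y, cosRemainder (θ * y) ∂ν
      = θ ^ 2 / 2 * v - ∫ y, (1 - Real.cos (θ * y)) ∂ν := by
    rw [hνeq, integral_sub (hν.const_mul _) (integrable_one_sub_cos hν θ), integral_const_mul]
  rw [← ofReal_integral_eq_lintegral_ofReal hPint
      (Filter.Eventually.of_forall fun ω => cosRemainder_nonneg _),
    ← ofReal_integral_eq_lintegral_ofReal hνint
      (Filter.Eventually.of_forall fun ω => cosRemainder_nonneg _),
    ← ENNReal.ofReal_add (integral_nonneg fun y => cosRemainder_nonneg _) (by positivity),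
    hPval, hνval]
  refine ENNReal.ofReal_le_ofReal ?_
  set ψ := ∫ y, (1 - Real.cos (θ * y)) ∂ν
  have hψ0 : 0 ≤ ψ := integral_one_sub_cos_nonneg ν θ
  have hψ : ψ ≤ θ ^ 2 / 2 * v := integral_one_sub_cos_le hν θ
  have hsq : (θ * √v) ^ 2 = θ ^ 2 * v := by rw [mul_pow, Real.sq_sqrt hv0]
  have hfour : (θ * √v) ^ 4 = (θ ^ 2 * v) ^ 2 := by rw [← hsq]; ring
  have hθv : 0 ≤ θ ^ 2 * v := by positivity
  have hmin : Real.exp (-ψ) - 1 + ψ ≤ min ((θ * √v) ^ 4) ((θ * √v) ^ 2) := by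
    rw [hsq, hfour]
    refine le_min ((exp_neg_sub_one_add_le_sq hψ0).trans ?_) ?_
    · exact pow_le_pow_left₀ hψ0 (by linarith) 2
    · linarith [Real.exp_le_one_iff.2 (neg_nonpos.2 hψ0)]
  linarith [mul_le_mul_of_nonneg_left hYle (by positivity : 0 ≤ θ ^ 2 / 2)]

/-- Tonelli's theorem for the weighted cosine remainder. -/
theorem lintegral_lintegral_cosRemainder_swap {α : Type*} [MeasurableSpace α] (μ : Measure α)
    [SFinite μ] {X : α → ℝ} (hX : Measurable X) (p : ℝ) :
    ∫⁻ a, (∫⁻ θ in Ioi (0 : ℝ), ENNReal.ofReal (cosRemainder (θ * X a) * θ ^ (-p - 1))) ∂μ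
      = ∫⁻ θ in Ioi (0 : ℝ),
        (∫⁻ a, ENNReal.ofReal (cosRemainder (θ * X a)) ∂μ) * ENNReal.ofReal (θ ^ (-p - 1)) := by
  have hg := continuous_cosRemainder.measurable
  rw [lintegral_lintegral_swap]
  · refine lintegral_congr fun θ => ?_
    rw [← lintegral_mul_const _ (by fun_prop)]
    exact lintegral_congr fun a => ENNReal.ofReal_mul (cosRemainder_nonneg _)
  · exact Measurable.aemeasurable (by fun_prop)

/-- Fractional moments of a symmetric infinitely divisible law, up to the factor
`4 ^ (1 - p) / (p - 2)`, are bounded by moments of its Lévy measure. -/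
theorem mul_lintegral_abs_rpow_le_of_integral_cos {p : ℝ} (hp2 : 2 < p) (hp4 : p < 4)
    {ν : Measure ℝ} [SigmaFinite ν] (hν : Integrable (fun y : ℝ => y ^ 2) ν)
    {Ω : Type*} [MeasurableSpace Ω] {P : Measure Ω} [IsProbabilityMeasure P]
    {Y : Ω → ℝ} (hY : Measurable Y)
    (h : ∀ θ : ℝ, ∫ ω, Real.cos (θ * Y ω) ∂P = Real.exp (-∫ y, (1 - Real.cos (θ * y)) ∂ν)) :
    ENNReal.ofReal (4 ^ (1 - p) / (p - 2)) * ∫⁻ ω, ENNReal.ofReal (|Y ω| ^ p) ∂P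
      ≤ ENNReal.ofReal (1 / (4 - p) + 1 / (p - 2)) *
        ((∫⁻ y, ENNReal.ofReal (|y| ^ p) ∂ν)
          + (∫⁻ y, ENNReal.ofReal (y ^ 2) ∂ν) ^ (p / 2)) := by
  set C := ENNReal.ofReal (1 / (4 - p) + 1 / (p - 2))
  set v := ∫ y, y ^ 2 ∂ν
  have hv0 : 0 ≤ v := integral_nonneg fun y => sq_nonneg y
  have hpow : (∫⁻ y, ENNReal.ofReal (y ^ 2) ∂ν) ^ (p / 2) = ENNReal.ofReal (√v ^ p) := by
    rw [← ofReal_integral_eq_lintegral_ofReal hν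
        (Filter.Eventually.of_forall fun y => sq_nonneg _),
      ENNReal.ofReal_rpow_of_nonneg hv0 (by linarith), Real.sqrt_eq_rpow, ← Real.rpow_mul hv0]
    congr 2
    ring
  have hg := continuous_cosRemainder.measurable
  calc ENNReal.ofReal (4 ^ (1 - p) / (p - 2)) * ∫⁻ ω, ENNReal.ofReal (|Y ω| ^ p) ∂P
      = ∫⁻ ω, ENNReal.ofReal (4 ^ (1 - p) / (p - 2)) * ENNReal.ofReal (|Y ω| ^ p) ∂P :=
        (lintegral_const_mul _ (by fun_prop)).symm
    _ ≤ ∫⁻ ω, (∫⁻ θ in Ioi (0 : ℝ),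
          ENNReal.ofReal (cosRemainder (θ * Y ω) * θ ^ (-p - 1))) ∂P :=
        lintegral_mono fun ω => le_lintegral_cosRemainder hp2 (Y ω)
    _ = ∫⁻ θ in Ioi (0 : ℝ), (∫⁻ ω, ENNReal.ofReal (cosRemainder (θ * Y ω)) ∂P)
          * ENNReal.ofReal (θ ^ (-p - 1)) := lintegral_lintegral_cosRemainder_swap P hY p
    _ ≤ ∫⁻ θ in Ioi (0 : ℝ), ((∫⁻ y, ENNReal.ofReal (cosRemainder (θ * y)) ∂ν)
            * ENNReal.ofReal (θ ^ (-p - 1))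
          + ENNReal.ofReal (min ((θ * √v) ^ 4) ((θ * √v) ^ 2) * θ ^ (-p - 1))) := by
        refine lintegral_mono fun θ => ?_
        rw [ENNReal.ofReal_mul (by positivity), ← add_mul]
        exact mul_le_mul_left (lintegral_cosRemainder_le_of_integral_cos hν hY h θ) _
    _ = (∫⁻ y, (∫⁻ θ in Ioi (0 : ℝ),
            ENNReal.ofReal (cosRemainder (θ * y) * θ ^ (-p - 1))) ∂ν)
          + ∫⁻ θ in Ioi (0 : ℝ),
            ENNReal.ofReal (min ((θ * √v) ^ 4) ((θ * √v) ^ 2) * θ ^ (-p - 1)) := by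
        rw [lintegral_add_right _ (by fun_prop),
          lintegral_lintegral_cosRemainder_swap ν measurable_id' p]
    _ ≤ (∫⁻ y, C * ENNReal.ofReal (|y| ^ p) ∂ν) + C * ENNReal.ofReal (√v ^ p) :=
        add_le_add (lintegral_mono fun y => lintegral_cosRemainder_le hp2 hp4 y)
          (lintegral_min_mul_rpow_le hp2 hp4 (Real.sqrt_nonneg v))
    _ = _ := by rw [lintegral_const_mul _ (by fun_prop), hpow, mul_add]

/-- Let `2 < p < 4`. There exists a constant `c_p ∈ (0,∞)`, depending only on `p`, such
that: for every symmetric σ-finite measure `ν` on `ℝ \ {0}` satisfying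
`∫ min(1, y²) ν(dy) < ∞` and `∫_{|y|≥1} y² ν(dy) < ∞`, and every random variable `Y` whose
characteristic function satisfies
`E[e^{iθY}] = exp(∫ (e^{iθy} − 1 − iθy) ν(dy))` for all `θ ∈ ℝ`, one has
`E[|Y|^p] ≤ c_p (∫ |y|^p ν(dy) + (∫ y² ν(dy))^{p/2})`. -/
theorem stmt_1 (p : ℝ) (hp2 : 2 < p) (hp4 : p < 4) :
    ∃ c : ℝ, 0 < c ∧
      ∀ (ν : Measure ℝ) [SigmaFinite ν],
        ν.map (fun y => -y) = ν →
        ν {0} = 0 →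
        (∫⁻ y, ENNReal.ofReal (min 1 (y ^ 2)) ∂ν) < ⊤ →
        (∫⁻ y in {y : ℝ | 1 ≤ |y|}, ENNReal.ofReal (y ^ 2) ∂ν) < ⊤ →
        ∀ (Ω : Type) (_ : MeasurableSpace Ω) (P : Measure Ω) (_ : IsProbabilityMeasure P)
          (Y : Ω → ℝ), Measurable Y →
          (∀ θ : ℝ,
            ∫ ω, Complex.exp (Complex.I * (θ : ℂ) * (Y ω : ℂ)) ∂P
              = Complex.exp
                  (∫ y, (Complex.exp (Complex.I * (θ : ℂ) * (y : ℂ))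
                          - 1 - Complex.I * (θ : ℂ) * (y : ℂ)) ∂ν)) →
          ∫⁻ ω, ENNReal.ofReal (|Y ω| ^ p) ∂P
            ≤ ENNReal.ofReal c *
                ((∫⁻ y, ENNReal.ofReal (|y| ^ p) ∂ν)
                  + (∫⁻ y, ENNReal.ofReal (y ^ 2) ∂ν) ^ (p / 2)) := by
  have h2 : 0 < p - 2 := by linarith
  have h4 : 0 < 4 - p := by linarith
  have hk : (0 : ℝ) < 4 ^ (1 - p) / (p - 2) := by positivity
  refine ⟨(1 / (4 - p) + 1 / (p - 2)) / (4 ^ (1 - p) / (p - 2)), by positivity, ?_⟩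
  intro ν _ hsymm _ hsmall hlarge Ω _ P _ Y hY hchar
  have hν := integrable_sq_of_lintegral_lt_top hsmall hlarge
  have hcos : ∀ θ : ℝ,
      ∫ ω, Real.cos (θ * Y ω) ∂P = Real.exp (-∫ y, (1 - Real.cos (θ * y)) ∂ν) := fun θ => by
    refine integral_cos_of_integral_exp hY ?_
    rw [hchar θ, integral_exp_sub_of_symmetric hsymm hν θ, Complex.ofReal_exp]
  have hmain := mul_lintegral_abs_rpow_le_of_integral_cos hp2 hp4 hν hY hcos
  rw [ENNReal.ofReal_div_of_pos hk, ENNReal.div_eq_inv_mul, mul_assoc]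
  refine (ENNReal.mul_le_iff_le_inv ?_ ENNReal.ofReal_ne_top).1 hmain
  exact (ENNReal.ofReal_pos.2 hk).ne'
end
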